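/- Let X and Y be real d×N matrices and L ≥ 0. If Xᵀ·Y = Yᵀ·X and Yᵀ·Y ⪯ L²·Xᵀ·X, then there exists a real symmetric d×d matrix M with σ_max(M) ≤ L (equivalently, −L·I ⪯ M ⪯ L·I) such that Y = M·X. -/

import Mathlib

open Matrix

theorem Matrix.IsHermitian.exists_symmetric_generalizedInverse {n : Type*} [Fintype n]
    [DecidableEq n] {C : Matrix n n ℝ} (hC : C.IsHermitian) :
    ∃ G : Matrix n n ℝ, Gᵀ = G ∧ C * G * C = C ∧ G * C * G = G := by
  have hC' : IsSelfAdjoint C := hC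
  have hcont (f : ℝ → ℝ) : ContinuousOn f (spectrum ℝ C) :=
    (Matrix.finite_real_spectrum (A := C)).continuousOn f
  have hid : cfc (fun x : ℝ => x) C = C := cfc_id' ℝ C
  refine ⟨cfc (fun x : ℝ => x⁻¹) C, ?_, ?_, ?_⟩
  · have h : IsSelfAdjoint (cfc (fun x : ℝ => x⁻¹) C) := cfc_predicate _ C
    simpa [IsSelfAdjoint, star_eq_conjTranspose] using h
  · have h : cfc (fun x : ℝ => x * x⁻¹ * x) C = C * cfc (fun x : ℝ => x⁻¹) C * C := by
      rw [cfc_mul _ _ C (hcont _) (hcont _), cfc_mul _ _ C (hcont _) (hcont _), hid]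
    simpa [hid] using h.symm
  · have h : cfc (fun x : ℝ => x⁻¹ * x * x⁻¹) C =
        cfc (fun x : ℝ => x⁻¹) C * C * cfc (fun x : ℝ => x⁻¹) C := by
      rw [cfc_mul _ _ C (hcont _) (hcont _), cfc_mul _ _ C (hcont _) (hcont _), hid]
    have hinv (x : ℝ) : x⁻¹ * x * x⁻¹ = x⁻¹ := by
      simpa using mul_inv_mul_cancel x⁻¹
    simpa only [hinv] using h.symm

theorem Matrix.eq_zero_of_posSemidef_neg_transpose_mul_self {m n : Type*} [Fintype m] [Fintype n]
    {B : Matrix m n ℝ} (h : (-(Bᵀ * B)).PosSemidef) : B = 0 := by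
  have hB : (Bᵀ * B).PosSemidef := by simpa using posSemidef_conjTranspose_mul_self B
  have h1 := h.trace_nonneg
  have h2 := hB.trace_nonneg
  rw [trace_neg] at h1
  have h3 : (Bᴴ * B).trace = 0 := by
    rw [conjTranspose_eq_transpose_of_trivial]; linarith
  exact trace_conjTranspose_mul_self_eq_zero_iff.mp h3

theorem Matrix.posSemidef_add_smul_one_of_sq_le {n : Type*} [Fintype n] [DecidableEq n]
    {L : ℝ} (hL : 0 ≤ L) {M : Matrix n n ℝ} (hM : Mᵀ = M)
    (h : (L ^ 2 • (1 : Matrix n n ℝ) - M * M).PosSemidef) :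
    (M + L • (1 : Matrix n n ℝ)).PosSemidef := by
  rcases hL.eq_or_lt with rfl | hL
  · have : M = 0 := eq_zero_of_posSemidef_neg_transpose_mul_self (by simpa [hM] using h)
    simpa [this] using PosSemidef.zero
  · have hsq : ((M + L • 1) * (M + L • 1) : Matrix n n ℝ).PosSemidef := by
      simpa [hM] using posSemidef_conjTranspose_mul_self (M + L • (1 : Matrix n n ℝ))
    have key : M + L • (1 : Matrix n n ℝ) =
        (2 * L)⁻¹ • ((M + L • 1) * (M + L • 1) + (L ^ 2 • (1 : Matrix n n ℝ) - M * M)) := by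
      rw [eq_inv_smul_iff₀ (by positivity)]
      simp only [add_mul, mul_add, smul_mul_assoc, mul_smul_comm, one_mul, mul_one]
      module
    rw [key]
    exact (hsq.add h).smul (by positivity)

/-- Sufficiency of symmetric-operator interpolation conditions: if `XᵀY = YᵀX` and
`YᵀY ⪯ L²·XᵀX`, then there is a symmetric matrix `M` with `−L·I ⪯ M ⪯ L·I`
(equivalently `σ_max(M) ≤ L`) such that `Y = M·X`. -/
theorem symmetric_operator_interpolation_sufficiency
    (d N : ℕ) (L : ℝ) (hL : 0 ≤ L)
    (X Y : Matrix (Fin d) (Fin N) ℝ)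
    (hsym : Xᵀ * Y = Yᵀ * X)
    (hbound : (L ^ 2 • (Xᵀ * X) - Yᵀ * Y).PosSemidef) :
    ∃ M : Matrix (Fin d) (Fin d) ℝ,
      Mᵀ = M ∧
      (M + L • (1 : Matrix (Fin d) (Fin d) ℝ)).PosSemidef ∧
      (L • (1 : Matrix (Fin d) (Fin d) ℝ) - M).PosSemidef ∧
      Y = M * X := by
  -- `M + L` is the minimal positive semidefinite extension `A C⁺ Aᵀ` of `X ↦ A`.
  obtain ⟨A, hA⟩ : ∃ A, A = Y + L • X := ⟨_, rfl⟩
  obtain ⟨C, hC⟩ : ∃ C, C = Aᵀ * X := ⟨_, rfl⟩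
  have hCT : Cᵀ = C := by
    simp [hC, hA, Matrix.add_mul, hsym]
  have hle : ((2 * L) • C - Aᵀ * A).PosSemidef := by
    convert hbound using 1
    simp only [hC, hA, transpose_add, transpose_smul, Matrix.add_mul, Matrix.mul_add,
      Matrix.smul_mul, Matrix.mul_smul, hsym]
    module
  obtain ⟨G, hGT, hCGC, hGCG⟩ :=
    IsHermitian.exists_symmetric_generalizedInverse (C := C)
      (by rw [IsHermitian, conjTranspose_eq_transpose_of_trivial, hCT])
  have hker : A * (1 - G * C) = 0 := by
    apply eq_zero_of_posSemidef_neg_transpose_mul_self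
    convert hle.conjTranspose_mul_mul_same (1 - G * C) using 1
    have h0 : C * (1 - G * C) = 0 := by rw [mul_sub, mul_one, ← mul_assoc, hCGC, sub_self]
    rw [conjTranspose_eq_transpose_of_trivial, mul_assoc, sub_mul, smul_mul, h0, smul_zero,
      zero_sub, transpose_mul, mul_neg]
    simp only [Matrix.mul_assoc]
  have hAGC : A * G * C = A := by
    rw [Matrix.mul_sub, Matrix.mul_one, sub_eq_zero, ← Matrix.mul_assoc] at hker
    exact hker.symm
  obtain ⟨M, hMdef⟩ : ∃ M, M = A * G * Aᵀ - L • (1 : Matrix (Fin d) (Fin d) ℝ) := ⟨_, rfl⟩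
  have hM : Mᵀ = M := by
    simp [hMdef, hGT, Matrix.mul_assoc]
  have hMM : (L ^ 2 • (1 : Matrix (Fin d) (Fin d) ℝ) - M * M).PosSemidef := by
    convert hle.mul_mul_conjTranspose_same (A * G) using 1
    have h1 : A * G * C * (G * Aᵀ) = A * G * Aᵀ := by
      calc A * G * C * (G * Aᵀ) = A * (G * C * G) * Aᵀ := by simp only [Matrix.mul_assoc]
        _ = _ := by rw [hGCG]
    have h2 : A * G * (Aᵀ * A) * (G * Aᵀ) = A * G * Aᵀ * (A * G * Aᵀ) := by
      simp only [Matrix.mul_assoc]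
    rw [conjTranspose_eq_transpose_of_trivial, transpose_mul, hGT, Matrix.mul_sub, Matrix.sub_mul,
      Matrix.mul_smul, Matrix.smul_mul, h1, h2, hMdef]
    simp only [mul_sub, sub_mul, smul_mul_assoc, mul_smul_comm, one_mul, mul_one]
    module
  refine ⟨M, hM, posSemidef_add_smul_one_of_sq_le hL hM hMM, ?_, ?_⟩
  · rw [sub_eq_neg_add]
    exact posSemidef_add_smul_one_of_sq_le hL (by rw [transpose_neg, hM]) (by rwa [neg_mul_neg])
  · rw [hMdef, Matrix.sub_mul, Matrix.mul_assoc (A * G), ← hC, hAGC, smul_mul, Matrix.one_mul, hA,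
      add_sub_cancel_right]
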